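/- Let F be special isothermic of type N with normalized polynomial conserved quantity P of degree N, and let F̂ be a regular Darboux transform of F with parameter μ (μ ≠ 0, μ·a_{ij} ≠ 1 on all edges) with ⟨F_i,F̂_i⟩ ≠ 0 at every vertex. Define P̂_i(λ) := (λ−μ)·P_i(λ) − (1/⟨F_i,F̂_i⟩)·((λ(λ−μ)/μ)·⟨P_i(λ),F_i⟩·F̂_i + λ·⟨P_i(λ),F̂_i⟩·F_i), which equals (λ−μ)·Γ^{1−λ/μ}_{F̂_i,F_i}(P_i(λ)) for λ ≠ μ. Then: (i) P̂ is a normalized polynomial conserved quantity of F̂ of degree N+1 (its top coefficient Ẑ satisfies ⟨Ẑ_i,Ẑ_i⟩ = 1); in particular F̂ is special isothermic of type ≤ N+1. (ii) If moreover ⟨P_i(μ),F̂_i⟩ = 0 at every vertex, then λ ↦ Γ^{1−λ/μ}_{F̂_i,F_i}(P_i(λ)) extends to a normalized polynomial conserved quantity of F̂ of degree N; in particular F̂ is special isothermic of type ≤ N. -/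

import Mathlib

noncomputable section

/-- The Minkowski bilinear form of signature (4,1) on `ℝ^5`. -/
def mink (x y : Fin 5 → ℝ) : ℝ :=
  -(x 0 * y 0) + x 1 * y 1 + x 2 * y 2 + x 3 * y 3 + x 4 * y 4

/-- The light cone `L⁴ ⊂ ℝ^{4,1}`. -/
def LightCone (x : Fin 5 → ℝ) : Prop :=
  x ≠ 0 ∧ mink x x = 0

/-- The map `Γ^q_{p,p'}` of the paper. -/
def Gamma (p p' : Fin 5 → ℝ) (q : ℝ) (X : Fin 5 → ℝ) : Fin 5 → ℝ :=
  X + (1 / mink p p') •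
    (((q - 1) * mink X p') • p + ((1 / q - 1) * mink X p) • p')

/-- Two vectors are proportional if one is a scalar multiple of the other. -/
def Proportional (x y : Fin 5 → ℝ) : Prop :=
  (∃ t : ℝ, y = t • x) ∨ (∃ t : ℝ, x = t • y)

/-- Membership in the rectangular grid `M`. -/
def InGrid (m₁ m₂ n₁ n₂ : ℤ) (i : ℤ × ℤ) : Prop :=
  m₁ ≤ i.1 ∧ i.1 ≤ m₂ ∧ n₁ ≤ i.2 ∧ i.2 ≤ n₂

/-- `(i,j)` is an edge of the grid (in either orientation). -/
def IsEdge (m₁ m₂ n₁ n₂ : ℤ) (i j : ℤ × ℤ) : Prop :=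
  InGrid m₁ m₂ n₁ n₂ i ∧ InGrid m₁ m₂ n₁ n₂ j ∧
    ((j.1 = i.1 + 1 ∧ j.2 = i.2) ∨ (i.1 = j.1 + 1 ∧ i.2 = j.2) ∨
     (j.1 = i.1 ∧ j.2 = i.2 + 1) ∨ (i.1 = j.1 ∧ i.2 = j.2 + 1))

/-- `(i,j,k,l)` is an elementary quadrilateral (face) of the grid. -/
def IsFace (m₁ m₂ n₁ n₂ : ℤ) (i j k l : ℤ × ℤ) : Prop :=
  InGrid m₁ m₂ n₁ n₂ i ∧ InGrid m₁ m₂ n₁ n₂ k ∧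
    j = (i.1 + 1, i.2) ∧ k = (i.1 + 1, i.2 + 1) ∧ l = (i.1, i.2 + 1)

/-- Four vectors are pairwise non-proportional. -/
def FaceRegular (v w x y : Fin 5 → ℝ) : Prop :=
  ¬ Proportional v w ∧ ¬ Proportional v x ∧ ¬ Proportional v y ∧
  ¬ Proportional w x ∧ ¬ Proportional w y ∧ ¬ Proportional x y

/-- A discrete isothermic net (with values in the light cone) with cross ratio
factorizing function `a`. -/
structure IsIsothermic (m₁ m₂ n₁ n₂ : ℤ) (F : ℤ × ℤ → Fin 5 → ℝ)
    (a : ℤ × ℤ → ℤ × ℤ → ℝ) : Prop where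
  lightcone : ∀ i, InGrid m₁ m₂ n₁ n₂ i → LightCone (F i)
  regular : ∀ i j k l, IsFace m₁ m₂ n₁ n₂ i j k l →
    FaceRegular (F i) (F j) (F k) (F l)
  symm : ∀ i j, IsEdge m₁ m₂ n₁ n₂ i j → a i j = a j i
  nonzero : ∀ i j, IsEdge m₁ m₂ n₁ n₂ i j → a i j ≠ 0
  opposite : ∀ i j k l, IsFace m₁ m₂ n₁ n₂ i j k l →
    a i j = a l k ∧ a i l = a j k
  cross : ∀ i j k l, IsFace m₁ m₂ n₁ n₂ i j k l →
    ∃ t : ℝ, t ≠ 0 ∧ F k = t • Gamma (F j) (F l) (a i j / a i l) (F i)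

/-- Evaluation of the polynomial with vector coefficients `P i 0, …, P i N`
at the spectral parameter `lam`. -/
def pcqEval (N : ℕ) (P : ℤ × ℤ → ℕ → Fin 5 → ℝ) (i : ℤ × ℤ) (lam : ℝ) :
    Fin 5 → ℝ :=
  ∑ k ∈ Finset.range (N + 1), lam ^ k • P i k

/-- `P` is a polynomial conserved quantity of degree at most `N` of the net `F`
with cross ratio factorizing function `a`. -/
def IsPCQ (m₁ m₂ n₁ n₂ : ℤ) (F : ℤ × ℤ → Fin 5 → ℝ) (a : ℤ × ℤ → ℤ × ℤ → ℝ)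
    (N : ℕ) (P : ℤ × ℤ → ℕ → Fin 5 → ℝ) : Prop :=
  ∀ i j, IsEdge m₁ m₂ n₁ n₂ i j → ∀ lam : ℝ, lam * a i j ≠ 1 →
    pcqEval N P i lam = Gamma (F i) (F j) (1 - lam * a i j) (pcqEval N P j lam)

/-- A polynomial conserved quantity is normalized (of degree `N`) if its top
coefficient has Minkowski square norm one at every vertex. -/
def Normalized (m₁ m₂ n₁ n₂ : ℤ) (N : ℕ) (P : ℤ × ℤ → ℕ → Fin 5 → ℝ) : Prop :=
  ∀ i, InGrid m₁ m₂ n₁ n₂ i → mink (P i N) (P i N) = 1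

/-- A Darboux transform of `F` with parameter `μ`. -/
def IsDarboux (m₁ m₂ n₁ n₂ : ℤ) (F : ℤ × ℤ → Fin 5 → ℝ) (a : ℤ × ℤ → ℤ × ℤ → ℝ)
    (μ : ℝ) (Fh : ℤ × ℤ → Fin 5 → ℝ) : Prop :=
  (∀ i, InGrid m₁ m₂ n₁ n₂ i → LightCone (Fh i)) ∧
  (∀ i, InGrid m₁ m₂ n₁ n₂ i → ¬ Proportional (F i) (Fh i)) ∧
  (∀ i j, IsEdge m₁ m₂ n₁ n₂ i j → Fh i = Gamma (F i) (F j) (1 - μ * a i j) (Fh j))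

/-- A Calapso transformation of `F` at parameter `μ`: a vertexwise family of
linear isometries of `ℝ^{4,1}` gauging the isothermic connection at `μ` to the
trivial connection. -/
def IsCalapso (m₁ m₂ n₁ n₂ : ℤ) (F : ℤ × ℤ → Fin 5 → ℝ) (a : ℤ × ℤ → ℤ × ℤ → ℝ)
    (μ : ℝ) (T : ℤ × ℤ → (Fin 5 → ℝ) → (Fin 5 → ℝ)) : Prop :=
  (∀ i, InGrid m₁ m₂ n₁ n₂ i → IsLinearMap ℝ (T i)) ∧
  (∀ i, InGrid m₁ m₂ n₁ n₂ i → ∀ x y, mink (T i x) (T i y) = mink x y) ∧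
  (∀ i j, IsEdge m₁ m₂ n₁ n₂ i j → ∀ x,
    T j x = T i (Gamma (F i) (F j) (1 - μ * a i j) x))

/-- scalar polynomial with coefficients `c 0, …, c N` -/
def spoly (N : ℕ) (c : ℕ → ℝ) : Polynomial ℝ :=
  ∑ k ∈ Finset.range (N + 1), Polynomial.monomial k (c k)

lemma spoly_eval (N : ℕ) (c : ℕ → ℝ) (x : ℝ) :
    (spoly N c).eval x = ∑ k ∈ Finset.range (N + 1), x ^ k * c k := by
  simp [spoly, Polynomial.eval_finsetSum, mul_comm]

lemma spoly_coeff (N : ℕ) (c : ℕ → ℝ) (k : ℕ) :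
    (spoly N c).coeff k = if k ≤ N then c k else 0 := by
  simp [spoly, Polynomial.coeff_monomial, Nat.lt_succ_iff]

lemma spoly_natDegree (N : ℕ) (c : ℕ → ℝ) : (spoly N c).natDegree ≤ N := by
  rw [Polynomial.natDegree_le_iff_coeff_eq_zero]
  intro k hk
  rw [spoly_coeff, if_neg (by omega)]

lemma mink_add_left (x y z : Fin 5 → ℝ) : mink (x + y) z = mink x z + mink y z := by
  simp [mink]; ring

lemma mink_smul_left (t : ℝ) (x z : Fin 5 → ℝ) : mink (t • x) z = t * mink x z := by
  simp [mink]; ring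

lemma mink_comm (x z : Fin 5 → ℝ) : mink x z = mink z x := by
  simp [mink]; ring

lemma mink_add_right (x y z : Fin 5 → ℝ) : mink z (x + y) = mink z x + mink z y := by
  simp [mink]; ring

lemma mink_smul_right (t : ℝ) (x z : Fin 5 → ℝ) : mink z (t • x) = t * mink z x := by
  simp [mink]; ring

lemma mink_pcqEval (N : ℕ) (P : ℤ × ℤ → ℕ → Fin 5 → ℝ) (i : ℤ × ℤ) (lam : ℝ)
    (v : Fin 5 → ℝ) :
    mink (pcqEval N P i lam) v = (spoly N (fun k => mink (P i k) v)).eval lam := by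
  rw [spoly_eval]
  unfold pcqEval
  induction Finset.range (N + 1) using Finset.induction_on with
  | empty => simp [mink]
  | insert a s ha ih => rw [Finset.sum_insert ha, Finset.sum_insert ha, mink_add_left,
      mink_smul_left, ih]

lemma pcqEval_apply (N : ℕ) (P : ℤ × ℤ → ℕ → Fin 5 → ℝ) (i : ℤ × ℤ) (lam : ℝ) (c : Fin 5) :
    pcqEval N P i lam c = (spoly N (fun k => P i k c)).eval lam := by
  rw [spoly_eval]
  simp [pcqEval]

lemma mink_ne_zero (x y : Fin 5 → ℝ) (hx : LightCone x) (hy : LightCone y)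
    (h : ¬ Proportional x y) : mink x y ≠ 0 := by
  intro h0
  obtain ⟨hx0, hxx⟩ := hx
  obtain ⟨-, hyy⟩ := hy
  have hx00 : x 0 ≠ 0 := by
    intro h00
    apply hx0
    simp only [mink, h00] at hxx
    have h1 : x 1 = 0 := by nlinarith [sq_nonneg (x 1), sq_nonneg (x 2), sq_nonneg (x 3), sq_nonneg (x 4)]
    have h2 : x 2 = 0 := by nlinarith [sq_nonneg (x 1), sq_nonneg (x 2), sq_nonneg (x 3), sq_nonneg (x 4)]
    have h3 : x 3 = 0 := by nlinarith [sq_nonneg (x 1), sq_nonneg (x 2), sq_nonneg (x 3), sq_nonneg (x 4)]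
    have h4 : x 4 = 0 := by nlinarith [sq_nonneg (x 1), sq_nonneg (x 2), sq_nonneg (x 3), sq_nonneg (x 4)]
    ext c; fin_cases c <;> simp [*]
  have key : (x 0 * y 1 - y 0 * x 1)^2 + (x 0 * y 2 - y 0 * x 2)^2 + (x 0 * y 3 - y 0 * x 3)^2
      + (x 0 * y 4 - y 0 * x 4)^2 = 0 := by
    simp only [mink] at h0 hxx hyy
    linear_combination (x 0)^2 * hyy + (y 0)^2 * hxx - 2 * x 0 * y 0 * h0
  apply h
  left
  refine ⟨y 0 / x 0, ?_⟩
  have e (c : Fin 5) (hc : (x 0 * y c - y 0 * x c)^2 = 0) : y c = y 0 / x 0 * x c := by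
    have := pow_eq_zero_iff (two_ne_zero) |>.1 hc
    field_simp; linarith
  ext c
  rw [Pi.smul_apply, smul_eq_mul]
  apply e
  have q1 := sq_nonneg (x 0 * y 1 - y 0 * x 1)
  have q2 := sq_nonneg (x 0 * y 2 - y 0 * x 2)
  have q3 := sq_nonneg (x 0 * y 3 - y 0 * x 3)
  have q4 := sq_nonneg (x 0 * y 4 - y 0 * x 4)
  fin_cases c
  · simp; ring
  all_goals simp only [Fin.mk_one, Fin.reduceFinMk]; linarith

lemma edge_ne (m₁ m₂ n₁ n₂ : ℤ) (hm : m₁ < m₂) (hn : n₁ < n₂)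
    (F : ℤ × ℤ → Fin 5 → ℝ) (a : ℤ × ℤ → ℤ × ℤ → ℝ)
    (hiso : IsIsothermic m₁ m₂ n₁ n₂ F a) (i j : ℤ × ℤ) (h : IsEdge m₁ m₂ n₁ n₂ i j) :
    mink (F i) (F j) ≠ 0 := by
  have H : ∀ m n : ℤ, m₁ ≤ m → m + 1 ≤ m₂ → n₁ ≤ n → n ≤ n₂ →
      mink (F (m, n)) (F (m+1, n)) ≠ 0 := by
    intro m n h1 h2 h3 h4
    have l1 := hiso.lightcone (m, n) ⟨h1, by simp; omega, h3, h4⟩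
    have l2 := hiso.lightcone (m+1, n) ⟨by simp; omega, h2, h3, h4⟩
    by_cases hh : n < n₂
    · have := (hiso.regular (m, n) (m+1, n) (m+1, n+1) (m, n+1)
        ⟨⟨h1, by simp; omega, h3, h4⟩, ⟨by simp; omega, h2, by simp; omega, by simp; omega⟩, rfl, rfl, rfl⟩)
      exact mink_ne_zero _ _ l1 l2 this.1
    · have := (hiso.regular (m, n-1) (m+1, n-1) (m+1, n) (m, n)
        ⟨⟨h1, by simp; omega, by simp; omega, by simp; omega⟩, ⟨by simp; omega, h2, by simp; omega, by simp; omega⟩, rfl, by simp, by simp⟩)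
      rw [mink_comm]
      exact mink_ne_zero _ _ l2 l1 this.2.2.2.2.2
  have V : ∀ m n : ℤ, m₁ ≤ m → m ≤ m₂ → n₁ ≤ n → n + 1 ≤ n₂ →
      mink (F (m, n)) (F (m, n+1)) ≠ 0 := by
    intro m n h1 h2 h3 h4
    have l1 := hiso.lightcone (m, n) ⟨h1, h2, h3, by simp; omega⟩
    have l2 := hiso.lightcone (m, n+1) ⟨h1, h2, by simp; omega, h4⟩
    by_cases hh : m < m₂
    · have := (hiso.regular (m, n) (m+1, n) (m+1, n+1) (m, n+1)
        ⟨⟨h1, h2, h3, by simp; omega⟩, ⟨by simp; omega, by simp; omega, by simp; omega, by simp; omega⟩, rfl, rfl, rfl⟩)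
      exact mink_ne_zero _ _ l1 l2 this.2.2.1
    · have := (hiso.regular (m-1, n) (m, n) (m, n+1) (m-1, n+1)
        ⟨⟨by simp; omega, by simp; omega, by simp; omega, by simp; omega⟩, ⟨by simp; omega, h2, by simp; omega, by simp; omega⟩, by simp, by simp, by simp⟩)
      exact mink_ne_zero _ _ l1 l2 this.2.2.2.1
  obtain ⟨⟨a1, a2, a3, a4⟩, ⟨b1, b2, b3, b4⟩, h⟩ := h
  obtain ⟨i1, i2⟩ := i
  obtain ⟨j1, j2⟩ := j
  simp only at *
  rcases h with ⟨rfl, rfl⟩ | ⟨rfl, rfl⟩ | ⟨rfl, rfl⟩ | ⟨rfl, rfl⟩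
  · exact H _ _ a1 b2 a3 a4
  · rw [mink_comm]; exact H _ _ b1 a2 b3 b4
  · exact V _ _ a1 a2 a3 b4
  · rw [mink_comm]; exact V _ _ b1 b2 b3 a4

lemma exists_edge (m₁ m₂ n₁ n₂ : ℤ) (hm : m₁ < m₂) (i : ℤ × ℤ) (h : InGrid m₁ m₂ n₁ n₂ i) :
    ∃ j, IsEdge m₁ m₂ n₁ n₂ j i := by
  obtain ⟨i1, i2⟩ := i
  obtain ⟨a1, a2, a3, a4⟩ := h
  simp only at *
  by_cases hh : i1 < m₂
  · refine ⟨(i1 + 1, i2), ?_⟩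
    simp [IsEdge, InGrid]; omega
  · refine ⟨(i1 - 1, i2), ?_⟩
    simp [IsEdge, InGrid]; omega

lemma gamma_comp (f g fh gh X : Fin 5 → ℝ) (a l μ : ℝ) (hf : mink f f = 0) (hg : mink g g = 0)
    (hgh : mink gh gh = 0) (ha : a ≠ 0) (hμ : μ ≠ 0) (hμa : μ * a ≠ 1) (hla : l * a ≠ 1)
    (hlμ : l ≠ μ) (hu : mink f g ≠ 0) (hv : mink g gh ≠ 0) (hw' : mink f fh ≠ 0)
    (hfh : fh = Gamma f g (1 - μ * a) gh) :
    Gamma fh f (1 - l / μ) (Gamma f g (1 - l * a) X)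
      = Gamma fh gh (1 - l * a) (Gamma gh g (1 - l / μ) X) := by
  have d1 : 1 - μ * a ≠ 0 := fun h => hμa (by linarith)
  have d2 : 1 - l * a ≠ 0 := fun h => hla (by linarith)
  have d3 : 1 - l / μ ≠ 0 := fun h => hlμ (by field_simp at h; linarith)
  have d3' : μ - l ≠ 0 := fun h => hlμ (by linarith)
  have e3 : 1 - l / μ = (μ - l) / μ := by field_simp
  obtain ⟨u, hu'⟩ : ∃ u, mink f g = u := ⟨_, rfl⟩
  obtain ⟨v, hv'⟩ : ∃ u, mink g gh = u := ⟨_, rfl⟩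
  obtain ⟨w, hw⟩ : ∃ u, mink f gh = u := ⟨_, rfl⟩
  obtain ⟨x1, hx1⟩ : ∃ u, mink X f = u := ⟨_, rfl⟩
  obtain ⟨x2, hx2⟩ : ∃ u, mink X g = u := ⟨_, rfl⟩
  obtain ⟨x3, hx3⟩ : ∃ u, mink X gh = u := ⟨_, rfl⟩
  have hgf : mink g f = u := by rw [mink_comm, hu']
  have hghg : mink gh g = v := by rw [mink_comm, hv']
  have hghf : mink gh f = w := by rw [mink_comm, hw]
  rw [hu'] at hu
  rw [hv'] at hv
  have F1 : fh = gh + (-(μ * a) * v / u) • f + ((μ * a) / (1 - μ * a) * w / u) • g := by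
    rw [hfh]
    unfold Gamma
    rw [hghg, hghf, hu']
    ext c
    simp only [Pi.add_apply, Pi.smul_apply, smul_eq_mul]
    field_simp
    ring
  have B1 : mink f fh = w / (1 - μ * a) := by
    rw [F1]
    simp only [mink_add_right, mink_smul_right, hf, hu', hw]
    field_simp
    ring
  have hw0 : w ≠ 0 := by
    rintro rfl
    apply hw'
    rw [B1]; simp
  have B1' : mink fh f = w / (1 - μ * a) := by rw [mink_comm, B1]
  have B2 : mink fh gh = v * w * (μ * a)^2 / (u * (1 - μ * a)) := by
    rw [F1]
    simp only [mink_add_left, mink_smul_left, hgh, hv', hw]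
    field_simp
    ring
  have B2' : mink gh fh = v * w * (μ * a)^2 / (u * (1 - μ * a)) := by rw [mink_comm, B2]
  have B3 : mink g fh = v * (1 - μ * a) := by
    rw [F1]
    simp only [mink_add_right, mink_smul_right, hgf, hv', hg]
    field_simp
    ring
  have B4 : mink X fh = x3 + (-(μ * a) * v / u) * x1 + ((μ * a) / (1 - μ * a) * w / u) * x2 := by
    rw [F1]
    simp only [mink_add_right, mink_smul_right, hx1, hx2, hx3]
  unfold Gamma
  simp only [mink_add_left, mink_smul_left, B1, B1', B2, B2', B3, B4, hx1, hx2, hx3, hu', hv', hw,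
    hgf, hghg, hghf, hf, hg, hgh, e3]
  rw [F1]
  ext c
  simp only [Pi.add_apply, Pi.smul_apply, smul_eq_mul]
  have d1' : 1 - a * μ ≠ 0 := by rwa [mul_comm]
  have d2' : 1 - a * l ≠ 0 := by rwa [mul_comm]
  field_simp
  ring

lemma gamma_smul (p p' : Fin 5 → ℝ) (q t : ℝ) (X : Fin 5 → ℝ) :
    Gamma p p' q (t • X) = t • Gamma p p' q X := by
  ext c
  simp only [Gamma, mink_smul_left, Pi.add_apply, Pi.smul_apply, smul_eq_mul]
  ring

lemma pcq_cont (p p' : Fin 5 → ℝ) (a μ : ℝ) (hμa : μ * a ≠ 1) (N : ℕ)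
    (C : ℤ × ℤ → ℕ → Fin 5 → ℝ) (i j : ℤ × ℤ)
    (h : ∀ l : ℝ, l * a ≠ 1 → l ≠ μ → 
      pcqEval N C i l = Gamma p p' (1 - l * a) (pcqEval N C j l)) :
    pcqEval N C i μ = Gamma p p' (1 - μ * a) (pcqEval N C j μ) := by
  have d1 : 1 - μ * a ≠ 0 := fun h => hμa (by linarith)
  ext c
  have hc : ∀ l : ℝ, l * a ≠ 1 → l ≠ μ → pcqEval N C i l c
      = Gamma p p' (1 - l * a) (pcqEval N C j l) c := fun l h1 h2 => by rw [h l h1 h2]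
  simp only [Gamma, Pi.add_apply, Pi.smul_apply, smul_eq_mul, mink_pcqEval, pcqEval_apply] at hc ⊢
  have c1 : ContinuousAt (fun l : ℝ => (spoly N (fun k => C i k c)).eval l) μ := by fun_prop
  have c2 : ContinuousAt (fun l : ℝ => (spoly N (fun k => C j k c)).eval l +
      1 / mink p p' * ((1 - l * a - 1) * (spoly N (fun k => mink (C j k) p')).eval l * p c +
      (1 / (1 - l * a) - 1) * (spoly N (fun k => mink (C j k) p)).eval l * p' c)) μ := by
    fun_prop (disch := assumption)
  refine tendsto_nhds_unique_of_eventuallyEq (l := nhdsWithin μ {μ}ᶜ)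
    (c1.tendsto.mono_left nhdsWithin_le_nhds) (c2.tendsto.mono_left nhdsWithin_le_nhds) ?_
  have o : ∀ᶠ l in nhdsWithin μ {μ}ᶜ, l * a ≠ 1 := by
    apply Filter.Eventually.filter_mono nhdsWithin_le_nhds
    exact ContinuousAt.eventually_ne (by fun_prop) hμa
  filter_upwards [o, self_mem_nhdsWithin] with l h1 h2
  exact hc l h1 h2

lemma top_orth (N : ℕ) (P : ℤ × ℤ → ℕ → Fin 5 → ℝ) (i j : ℤ × ℤ) (f g : Fin 5 → ℝ) (a : ℝ)
    (ha : a ≠ 0) (hu : mink f g ≠ 0) (hg : mink g g = 0)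
    (h : ∀ l : ℝ, l * a ≠ 1 → pcqEval N P i l = Gamma f g (1 - l * a) (pcqEval N P j l)) :
    mink (P j N) g = 0 := by
  have e : spoly N (fun k => mink (P i k) g)
      = spoly N (fun k => mink (P j k) g)
        - Polynomial.C a * spoly N (fun k => mink (P j k) g) * Polynomial.X := by
    apply Polynomial.eq_of_infinite_eval_eq
    refine Set.Infinite.mono (s := {a⁻¹}ᶜ) ?_ (Set.Finite.infinite_compl (Set.finite_singleton _))
    intro l hl
    have hl' : l * a ≠ 1 := fun h => hl (by simp; field_simp; linarith)
    have := congrArg (fun v => mink v g) (h l hl')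
    simp only [Gamma, mink_add_left, mink_smul_left, hg] at this
    simp only [mink_pcqEval] at this
    simp only [Set.mem_ofPred_eq, Polynomial.eval_sub, Polynomial.eval_mul, Polynomial.eval_C,
      Polynomial.eval_X]
    rw [this]
    field_simp
    ring
  have := congrArg (fun p => p.coeff (N + 1)) e
  simp [spoly_coeff, ha] at this
  exact this

/-- coordinate polynomial of the transformed conserved quantity -/
def hatPoly (N : ℕ) (Pi : ℕ → Fin 5 → ℝ) (f fh : Fin 5 → ℝ) (μ : ℝ) (c : Fin 5) :
    Polynomial ℝ :=
  Polynomial.X * spoly N (fun k => Pi k c) - Polynomial.C μ * spoly N (fun k => Pi k c)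
    - Polynomial.C (1 / mink f fh * (1 / μ) * fh c) *
        (Polynomial.X * (Polynomial.X * spoly N (fun k => mink (Pi k) f)))
    + Polynomial.C (1 / mink f fh * fh c) *
        (Polynomial.X * spoly N (fun k => mink (Pi k) f))
    - Polynomial.C (1 / mink f fh * f c) *
        (Polynomial.X * spoly N (fun k => mink (Pi k) fh))

lemma hatPoly_natDegree (N : ℕ) (Pi : ℕ → Fin 5 → ℝ) (f fh : Fin 5 → ℝ) (μ : ℝ) (c : Fin 5)
    (h : mink (Pi N) f = 0) : (hatPoly N Pi f fh μ c).natDegree ≤ N + 1 := by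
  rw [Polynomial.natDegree_le_iff_coeff_eq_zero]
  intro k hk
  obtain ⟨k, rfl⟩ : ∃ k', k = k' + 2 := ⟨k - 2, by omega⟩
  have e : (if k ≤ N then mink (Pi k) f else 0) = 0 := by
    split_ifs with h1
    · rw [show k = N by omega, h]
    · rfl
  simp only [hatPoly, Polynomial.coeff_sub, Polynomial.coeff_add, Polynomial.coeff_C_mul,
    Polynomial.coeff_X_mul, spoly_coeff, e]
  simp [show ¬ (k + 1 ≤ N) by omega, show ¬ (k + 2 ≤ N) by omega]

lemma hatPoly_top (N : ℕ) (Pi : ℕ → Fin 5 → ℝ) (f fh : Fin 5 → ℝ) (μ : ℝ) 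
    (h : mink (Pi N) f = 0) (h1 : mink (Pi N) (Pi N) = 1) (hf : mink f f = 0)
    (hfh : mink fh fh = 0) (hs : mink f fh ≠ 0) :
    mink (fun c => (hatPoly N Pi f fh μ c).coeff (N + 1))
      (fun c => (hatPoly N Pi f fh μ c).coeff (N + 1)) = 1 := by
  obtain ⟨d, hd⟩ : ∃ d, (Polynomial.X * spoly N (fun k => mink (Pi k) f)).coeff N = d := ⟨_, rfl⟩
  have e : (fun c => (hatPoly N Pi f fh μ c).coeff (N + 1))
      = Pi N + (-(1 / mink f fh * (1 / μ) * d)) • fh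
        + (-(1 / mink f fh * mink (Pi N) fh)) • f := by
    ext c
    simp only [hatPoly, Polynomial.coeff_sub, Polynomial.coeff_add, Polynomial.coeff_C_mul,
      Polynomial.coeff_X_mul, hd, spoly_coeff]
    simp [h]
    ring
  rw [e]
  simp only [mink_add_left, mink_add_right, mink_smul_left, mink_smul_right, h, h1, hf, hfh,
    mink_comm f (Pi N), mink_comm fh (Pi N), mink_comm fh f]
  field_simp
  ring

lemma pcqEval_coeff (N : ℕ) (q : ℤ × ℤ → Fin 5 → Polynomial ℝ) (i : ℤ × ℤ) (l : ℝ)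
    (h : ∀ c, (q i c).natDegree ≤ N) :
    pcqEval N (fun i k c => (q i c).coeff k) i l = fun c => (q i c).eval l := by
  ext c
  rw [pcqEval_apply, spoly_eval, Polynomial.eval_eq_sum_range' (Nat.lt_succ_of_le (h c))]
  exact Finset.sum_congr rfl fun k _ => mul_comm _ _

lemma hat_eq_gamma (f fh X : Fin 5 → ℝ) (l μ : ℝ) (hμ : μ ≠ 0) (hl : l ≠ μ) :
    (l - μ) • X - (1 / mink f fh) • (((l * (l - μ) / μ) * mink X f) • fh + (l * mink X fh) • f)
      = (l - μ) • Gamma fh f (1 - l / μ) X := by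
  have d3' : μ - l ≠ 0 := fun h => hl (by linarith)
  have e3 : 1 - l / μ = (μ - l) / μ := by field_simp
  have e4 : 1 / (1 - l / μ) - 1 = l / (μ - l) := by rw [e3]; field_simp; ring
  ext c
  simp only [Gamma, Pi.add_apply, Pi.sub_apply, Pi.smul_apply, smul_eq_mul, mink_comm fh f, e4]
  obtain ⟨t, ht⟩ : ∃ t, 1 / mink f fh = t := ⟨_, rfl⟩
  rw [ht]
  field_simp
  ring

/-- a Darboux transform of a special isothermic net of type `N`
is special isothermic of type at most `N+1`, and of type at most `N` in case of
a Bäcklund transform. -/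
theorem statement13 (m₁ m₂ n₁ n₂ : ℤ) (hm : m₁ < m₂) (hn : n₁ < n₂)
    (F Fh : ℤ × ℤ → Fin 5 → ℝ) (a : ℤ × ℤ → ℤ × ℤ → ℝ) (N : ℕ)
    (hiso : IsIsothermic m₁ m₂ n₁ n₂ F a)
    (P : ℤ × ℤ → ℕ → Fin 5 → ℝ)
    (hP : IsPCQ m₁ m₂ n₁ n₂ F a N P) (hPnorm : Normalized m₁ m₂ n₁ n₂ N P)
    (hmin : ∀ K : ℕ, K < N → ∀ P' : ℤ × ℤ → ℕ → Fin 5 → ℝ,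
      IsPCQ m₁ m₂ n₁ n₂ F a K P' → ¬ Normalized m₁ m₂ n₁ n₂ K P')
    (μ : ℝ) (hμ0 : μ ≠ 0)
    (hadm : ∀ i j, IsEdge m₁ m₂ n₁ n₂ i j → μ * a i j ≠ 1)
    (hD : IsDarboux m₁ m₂ n₁ n₂ F a μ Fh)
    (hreg : ∀ i j k l, IsFace m₁ m₂ n₁ n₂ i j k l →
      FaceRegular (Fh i) (Fh j) (Fh k) (Fh l))
    (hprod : ∀ i, InGrid m₁ m₂ n₁ n₂ i → mink (F i) (Fh i) ≠ 0)
    (Phat : ℤ × ℤ → ℝ → Fin 5 → ℝ)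
    (hPhat : ∀ i lam, Phat i lam
      = (lam - μ) • pcqEval N P i lam
        - (1 / mink (F i) (Fh i)) •
            (((lam * (lam - μ) / μ) * mink (pcqEval N P i lam) (F i)) • Fh i
              + (lam * mink (pcqEval N P i lam) (Fh i)) • F i)) :
    (∀ i, InGrid m₁ m₂ n₁ n₂ i → ∀ lam : ℝ, lam ≠ μ →
      Phat i lam
        = (lam - μ) • Gamma (Fh i) (F i) (1 - lam / μ) (pcqEval N P i lam)) ∧
    (∃ C : ℤ × ℤ → ℕ → Fin 5 → ℝ,
      (∀ i, InGrid m₁ m₂ n₁ n₂ i → ∀ lam : ℝ,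
        pcqEval (N + 1) C i lam = Phat i lam) ∧
      IsPCQ m₁ m₂ n₁ n₂ Fh a (N + 1) C ∧
      Normalized m₁ m₂ n₁ n₂ (N + 1) C) ∧
    ((∀ i, InGrid m₁ m₂ n₁ n₂ i → mink (pcqEval N P i μ) (Fh i) = 0) →
      ∃ C : ℤ × ℤ → ℕ → Fin 5 → ℝ,
        (∀ i, InGrid m₁ m₂ n₁ n₂ i → ∀ lam : ℝ, lam ≠ μ →
          pcqEval N C i lam
            = Gamma (Fh i) (F i) (1 - lam / μ) (pcqEval N P i lam)) ∧
        IsPCQ m₁ m₂ n₁ n₂ Fh a N C ∧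
        Normalized m₁ m₂ n₁ n₂ N C) := by
  have G : ∀ i lam, lam ≠ μ →
      Phat i lam = (lam - μ) • Gamma (Fh i) (F i) (1 - lam / μ) (pcqEval N P i lam) := by
    intro i lam hl
    rw [hPhat, hat_eq_gamma _ _ _ _ _ hμ0 hl]
  have orth : ∀ i, InGrid m₁ m₂ n₁ n₂ i → mink (P i N) (F i) = 0 := by
    intro i hi
    obtain ⟨j, hj⟩ := exists_edge m₁ m₂ n₁ n₂ hm i hi
    exact top_orth N P j i (F j) (F i) (a j i) (hiso.nonzero j i hj)
      (edge_ne _ _ _ _ hm hn F a hiso j i hj) (hiso.lightcone i hi).2 (hP j i hj)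
  have edge : ∀ i j, IsEdge m₁ m₂ n₁ n₂ i j → ∀ lam : ℝ, lam * a i j ≠ 1 → lam ≠ μ →
      Gamma (Fh i) (F i) (1 - lam / μ) (pcqEval N P i lam)
        = Gamma (Fh i) (Fh j) (1 - lam * a i j)
          (Gamma (Fh j) (F j) (1 - lam / μ) (pcqEval N P j lam)) := by
    intro i j hij lam h1 h2
    rw [hP i j hij lam h1]
    exact gamma_comp _ _ _ _ _ _ _ _ (hiso.lightcone i hij.1).2 (hiso.lightcone j hij.2.1).2
      (hD.1 j hij.2.1).2 (hiso.nonzero i j hij) hμ0 (hadm i j hij) h1 h2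
      (edge_ne _ _ _ _ hm hn F a hiso i j hij) (hprod j hij.2.1) (hprod i hij.1)
      (hD.2.2 i j hij)
  let q : ℤ × ℤ → Fin 5 → Polynomial ℝ := fun i c => hatPoly N (P i) (F i) (Fh i) μ c
  have qdeg : ∀ i, InGrid m₁ m₂ n₁ n₂ i → ∀ c, (q i c).natDegree ≤ N + 1 :=
    fun i hi c => hatPoly_natDegree _ _ _ _ _ _ (orth i hi)
  have qeval : ∀ i lam c, (q i c).eval lam = Phat i lam c := by
    intro i lam c
    rw [hPhat]
    simp only [mink_pcqEval, Pi.add_apply, Pi.sub_apply, Pi.smul_apply, smul_eq_mul,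
      pcqEval_apply]
    simp only [q, hatPoly, Polynomial.eval_sub, Polynomial.eval_add, Polynomial.eval_mul,
      Polynomial.eval_C, Polynomial.eval_X]
    field_simp
    ring
  have qtop : ∀ i, InGrid m₁ m₂ n₁ n₂ i →
      mink (fun c => (q i c).coeff (N + 1)) (fun c => (q i c).coeff (N + 1)) = 1 :=
    fun i hi => hatPoly_top _ _ _ _ _ (orth i hi) (hPnorm i hi) (hiso.lightcone i hi).2
      (hD.1 i hi).2 (hprod i hi)
  refine ⟨fun i _ lam hl => G i lam hl, ⟨fun i k c => (q i c).coeff k, ?_, ?_, ?_⟩, ?_⟩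
  · intro i hi lam
    rw [pcqEval_coeff _ _ _ _ (qdeg i hi)]
    ext c
    exact qeval i lam c
  · have ev : ∀ i, InGrid m₁ m₂ n₁ n₂ i → ∀ lam,
        pcqEval (N + 1) (fun i k c => (q i c).coeff k) i lam = Phat i lam := by
      intro i hi lam
      rw [pcqEval_coeff _ _ _ _ (qdeg i hi)]
      ext c
      exact qeval i lam c
    have main : ∀ i j, IsEdge m₁ m₂ n₁ n₂ i j → ∀ lam : ℝ, lam * a i j ≠ 1 → lam ≠ μ →
        pcqEval (N + 1) (fun i k c => (q i c).coeff k) i lam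
          = Gamma (Fh i) (Fh j) (1 - lam * a i j)
            (pcqEval (N + 1) (fun i k c => (q i c).coeff k) j lam) := by
      intro i j hij lam h1 h2
      rw [ev i hij.1, ev j hij.2.1, G i lam h2, G j lam h2, gamma_smul, edge i j hij lam h1 h2]
    intro i j hij lam h1
    by_cases h2 : lam = μ
    · subst h2
      exact pcq_cont _ _ _ _ h1 _ _ _ _ (main i j hij)
    · exact main i j hij lam h1 h2
  · exact qtop
  · intro hB
    let r : ℤ × ℤ → Fin 5 → Polynomial ℝ := fun i c => q i c /ₘ (Polynomial.X - Polynomial.C μ)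
    have fac : ∀ i, InGrid m₁ m₂ n₁ n₂ i → ∀ c,
        (Polynomial.X - Polynomial.C μ) * r i c = q i c := by
      intro i hi c
      apply Polynomial.mul_divByMonic_eq_iff_isRoot.2
      rw [Polynomial.IsRoot, qeval, hPhat, hB i hi]
      simp
    have rdeg : ∀ i, InGrid m₁ m₂ n₁ n₂ i → ∀ c, (r i c).natDegree ≤ N := by
      intro i hi c
      have := Polynomial.natDegree_divByMonic (q i c) (Polynomial.monic_X_sub_C μ)
      rw [Polynomial.natDegree_X_sub_C] at this
      have h2 := qdeg i hi c
      change (q i c /ₘ (Polynomial.X - Polynomial.C μ)).natDegree ≤ N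
      omega
    have rtop : ∀ i, InGrid m₁ m₂ n₁ n₂ i → ∀ c, (r i c).coeff N = (q i c).coeff (N + 1) := by
      intro i hi c
      rw [← fac i hi c, sub_mul, Polynomial.coeff_sub, Polynomial.coeff_X_mul,
        Polynomial.coeff_C_mul,
        Polynomial.coeff_eq_zero_of_natDegree_lt (Nat.lt_succ_of_le (rdeg i hi c))]
      simp
    have ev : ∀ i, InGrid m₁ m₂ n₁ n₂ i → ∀ lam, lam ≠ μ →
        pcqEval N (fun i k c => (r i c).coeff k) i lam
          = Gamma (Fh i) (F i) (1 - lam / μ) (pcqEval N P i lam) := by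
      intro i hi lam hl
      rw [pcqEval_coeff _ _ _ _ (rdeg i hi)]
      ext c
      have h1 := congrArg (fun p => Polynomial.eval lam p) (fac i hi c)
      simp only [Polynomial.eval_mul, Polynomial.eval_sub, Polynomial.eval_X,
        Polynomial.eval_C] at h1
      rw [qeval, G i lam hl, Pi.smul_apply, smul_eq_mul] at h1
      exact mul_left_cancel₀ (sub_ne_zero.2 hl) h1
    have main : ∀ i j, IsEdge m₁ m₂ n₁ n₂ i j → ∀ lam : ℝ, lam * a i j ≠ 1 → lam ≠ μ →
        pcqEval N (fun i k c => (r i c).coeff k) i lam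
          = Gamma (Fh i) (Fh j) (1 - lam * a i j)
            (pcqEval N (fun i k c => (r i c).coeff k) j lam) := by
      intro i j hij lam h1 h2
      rw [ev i hij.1 lam h2, ev j hij.2.1 lam h2, edge i j hij lam h1 h2]
    refine ⟨fun i k c => (r i c).coeff k, ev, ?_, ?_⟩
    · intro i j hij lam h1
      by_cases h2 : lam = μ
      · subst h2
        exact pcq_cont _ _ _ _ h1 _ _ _ _ (main i j hij)
      · exact main i j hij lam h1 h2
    · intro i hi
      have e : (fun c => (r i c).coeff N) = (fun c => (q i c).coeff (N + 1)) := by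
        ext c; exact rtop i hi c
      change mink (fun c => (r i c).coeff N) (fun c => (r i c).coeff N) = 1
      rw [e]
      exact qtop i hi
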